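/- Let (X,d,m) be a k-Ahlfors regular PI space with k > 1. Then there exists a constant C'_I > 0 such that min{ m(E), m(X \ E) } ≤ C'_I · P(E)^{k/(k−1)} for every set E ⊆ X of finite perimeter. -/

import Mathlib

open MeasureTheory Metric Filter Set
open scoped ENNReal NNReal Topology

namespace PaperBV

noncomputable section

variable {X : Type*} [MetricSpace X]

/-- `f` is locally Lipschitz on `Ω`. -/
def LocLipOn (Ω : Set X) (f : X → ℝ) : Prop :=
  ∀ x ∈ Ω, ∃ K : ℝ≥0, ∃ t ∈ 𝓝[Ω] x, LipschitzOnWith K f t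

/-- The local Lipschitz constant (slope) `lip f` of a function, with value `0` at
points that are not accumulation points (there the filter `𝓝[≠] x` is trivial). -/
def lipConst (f : X → ℝ) (x : X) : ℝ≥0∞ :=
  Filter.limsup (fun y => ENNReal.ofReal (|f y - f x| / dist y x)) (𝓝[≠] x)

variable [MeasurableSpace X]

/-- Convergence `fn → f` in `L¹_loc(μ⌊Ω)`. -/
def TendstoL1loc (μ : Measure X) (Ω : Set X) (fn : ℕ → X → ℝ) (f : X → ℝ) : Prop :=
  ∀ K : Set X, IsCompact K → K ⊆ Ω →
    Filter.Tendsto (fun n => ∫⁻ x in K, ENNReal.ofReal |fn n x - f x| ∂μ)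
      Filter.atTop (𝓝 0)

/-- The total variation `|Df|(Ω)` of `f` on an open set `Ω`, defined by relaxation of the
integral of the local Lipschitz constant along locally Lipschitz approximations. -/
def tvOpen (μ : Measure X) (f : X → ℝ) (Ω : Set X) : ℝ≥0∞ :=
  sInf { a : ℝ≥0∞ | ∃ fn : ℕ → X → ℝ, (∀ n, LocLipOn Ω (fn n)) ∧ TendstoL1loc μ Ω fn f ∧
    a = Filter.liminf (fun n => ∫⁻ x in Ω, lipConst (fn n) x ∂μ) Filter.atTop }

/-- The total variation measure `|Df|(B)` of `f` on an arbitrary set, obtained from the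
values on open sets by the Carathéodory construction. -/
def tv (μ : Measure X) (f : X → ℝ) (B : Set X) : ℝ≥0∞ :=
  ⨅ (Ω : Set X) (_ : IsOpen Ω) (_ : B ⊆ Ω), tvOpen μ f Ω

/-- `f` is a function of bounded variation: `f ∈ L¹(μ)` and `|Df|(X) < ∞`. -/
def BVFun (μ : Measure X) (f : X → ℝ) : Prop :=
  MeasureTheory.Integrable f μ ∧ tv μ f Set.univ < ⊤

/-- The perimeter `P(E, B) = |D 1_E|(B)`. -/
def perim (μ : Measure X) (E B : Set X) : ℝ≥0∞ :=
  tv μ (E.indicator fun _ => (1 : ℝ)) B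

/-- `E` is a (Borel) set of finite perimeter. -/
def FinPerim (μ : Measure X) (E : Set X) : Prop :=
  MeasurableSet E ∧ perim μ E Set.univ < ⊤

/-- `μ` is a doubling measure with doubling constant `CD`. -/
def Doubling (μ : Measure X) (CD : ℝ≥0) : Prop :=
  1 ≤ CD ∧ ∀ (x : X) (r : ℝ), 0 < r → μ (ball x (2 * r)) ≤ (CD : ℝ≥0∞) * μ (ball x r)

/-- The mean value `f_{x,r}` of `f` on the ball `B_r(x)`. -/
def ballAvg (μ : Measure X) (f : X → ℝ) (x : X) (r : ℝ) : ℝ :=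
  (∫ y in ball x r, f y ∂μ) / (μ (ball x r)).toReal

/-- The weak `(1,1)`-Poincaré inequality with constants `CP`, `lam`,
for locally Lipschitz functions. -/
def WeakPoincare (μ : Measure X) (CP lam : ℝ) : Prop :=
  ∀ f : X → ℝ, LocLipOn Set.univ f → ∀ (x : X) (r : ℝ), 0 < r →
    ∫⁻ y in ball x r, ENNReal.ofReal |f y - ballAvg μ f x r| ∂μ ≤
      ENNReal.ofReal (CP * r) * ∫⁻ y in ball x (lam * r), lipConst f y ∂μ

/-- A PI space: doubling and supporting a weak `(1,1)`-Poincaré inequality. -/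
def IsPI (μ : Measure X) : Prop :=
  ∃ (CD : ℝ≥0) (CP lam : ℝ), Doubling μ CD ∧ 0 < CP ∧ 1 ≤ lam ∧ WeakPoincare μ CP lam

/-- The pre-measure `H_δ` of the codimension-one Hausdorff measure: infimum over countable
covers by balls of radii at most `δ` of `∑ μ(B_{r_i}(x_i)) / (2 r_i)`. -/
def preH (μ : Measure X) (δ : ℝ) (S : Set X) : ℝ≥0∞ :=
  ⨅ (c : ℕ → X × ℝ) (_ : ∀ i, 0 < (c i).2 ∧ (c i).2 ≤ δ)
    (_ : S ⊆ ⋃ i, ball (c i).1 (c i).2),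
    ∑' i, μ (ball (c i).1 (c i).2) / ENNReal.ofReal (2 * (c i).2)

/-- The codimension-one Hausdorff measure `H = lim_{δ ↓ 0} H_δ = sup_{δ > 0} H_δ`
(as an outer-measure-type set function). -/
def codimH (μ : Measure X) (S : Set X) : ℝ≥0∞ :=
  ⨆ (δ : ℝ) (_ : 0 < δ), preH μ δ S

/-- The upper density of `E` at `x`. -/
def upperDens (μ : Measure X) (E : Set X) (x : X) : ℝ≥0∞ :=
  Filter.limsup (fun r : ℝ => μ (E ∩ ball x r) / μ (ball x r)) (𝓝[>] (0 : ℝ))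

/-- The essential boundary `∂^e E`. -/
def essBdry (μ : Measure X) (E : Set X) : Set X :=
  {x | 0 < upperDens μ E x ∧ 0 < upperDens μ Eᶜ x}

/-- The essential interior `E^1`: points of density `1`. -/
def essInt (μ : Measure X) (E : Set X) : Set X :=
  {x | Filter.Tendsto (fun r : ℝ => μ (E ∩ ball x r) / μ (ball x r))
    (𝓝[>] (0 : ℝ)) (𝓝 (1 : ℝ≥0∞))}

/-- Integral `∫_S f dν` with respect to an outer-measure-type set function `ν`,
via the layer-cake formula. -/
def outerLint (ν : Set X → ℝ≥0∞) (S : Set X) (f : X → ℝ≥0∞) : ℝ≥0∞ :=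
  ∫⁻ t in Set.Ioi (0 : ℝ), ν {x ∈ S | ENNReal.ofReal t < f x}

/-- `θ` is a family of densities representing the perimeter measures with respect to the
codimension-one Hausdorff measure: `P(E,B) = ∫_{B ∩ ∂^e E} θ_E dH`, with
`γ ≤ θ_E ≤ C` on `∂^e E` for structural constants `0 < γ`, `C < ∞`. -/
def PerimRepr (μ : Measure X) (θ : Set X → X → ℝ≥0∞) : Prop :=
  ∃ γ C : ℝ≥0∞, 0 < γ ∧ C ≠ ⊤ ∧
    ∀ E : Set X, FinPerim μ E →
      (∀ x ∈ essBdry μ E, γ ≤ θ E x ∧ θ E x ≤ C) ∧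
      ∀ B : Set X, MeasurableSet B →
        perim μ E B = outerLint (codimH μ) (B ∩ essBdry μ E) (θ E)

/-- The space is isotropic: the densities `θ_E` can be chosen so that, whenever `F ⊆ E` are
sets of finite perimeter, `θ_F = θ_E` holds `H`-a.e. on `∂^e F ∩ ∂^e E`. -/
def Isotropic (μ : Measure X) : Prop :=
  ∃ θ : Set X → X → ℝ≥0∞, PerimRepr μ θ ∧
    ∀ E F : Set X, FinPerim μ E → FinPerim μ F → F ⊆ E →
      codimH μ {x ∈ essBdry μ F ∩ essBdry μ E | θ F x ≠ θ E x} = 0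

/-- Property (1.2): `H(∂^e E ∩ ∂^e F ∩ ∂^e (E ∪ F)) = 0` for disjoint sets of finite
perimeter. -/
def Prop12 (μ : Measure X) : Prop :=
  ∀ E F : Set X, FinPerim μ E → FinPerim μ F → Disjoint E F →
    codimH μ (essBdry μ E ∩ essBdry μ F ∩ essBdry μ (E ∪ F)) = 0

/-- `E` is decomposable in `B`: `E ∩ B` admits a partition into two sets of finite perimeter
and positive measure such that the perimeter in `B` is additive. -/
def DecomposableIn (μ : Measure X) (E B : Set X) : Prop :=
  ∃ F G : Set X, FinPerim μ F ∧ FinPerim μ G ∧ Disjoint F G ∧ F ∪ G = E ∩ B ∧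
    0 < μ F ∧ 0 < μ G ∧ perim μ E B = perim μ F B + perim μ G B

/-- `E` is a set of finite perimeter which is indecomposable in `B`. -/
def IndecomposableIn (μ : Measure X) (E B : Set X) : Prop :=
  FinPerim μ E ∧ ¬ DecomposableIn μ E B

/-- `E` is an indecomposable set (of finite perimeter). -/
def Indecomposable (μ : Measure X) (E : Set X) : Prop :=
  IndecomposableIn μ E Set.univ

/-- `E` is a simple set. -/
def SimpleSet (μ : Measure X) (E : Set X) : Prop :=
  FinPerim μ E ∧ μ E < ⊤ ∧
  ∀ F : Set X, FinPerim μ F → codimH μ (essBdry μ F \ essBdry μ E) = 0 →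
    μ F = 0 ∨ μ Fᶜ = 0 ∨ μ (symmDiff F E) = 0 ∨ μ (symmDiff F Eᶜ) = 0

end

variable {X : Type*} [MetricSpace X] [CompleteSpace X] [TopologicalSpace.SeparableSpace X]
  [MeasurableSpace X] [BorelSpace X]

/-- `μ` is `k`-Ahlfors regular. -/
def AhlforsRegular (μ : Measure X) (k : ℝ) : Prop :=
  ∃ a a2 : ℝ, 0 < a ∧ a ≤ a2 ∧ ∀ (x : X) (r : ℝ), 0 < r →
    ENNReal.ofReal r < EMetric.diam (Set.univ : Set X) →
      ENNReal.ofReal (a * r ^ k) ≤ μ (Metric.ball x r) ∧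
      μ (Metric.ball x r) ≤ ENNReal.ofReal (a2 * r ^ k)

theorem LocLipOn.continuous
    {X : Type*} [MetricSpace X]
    {f : X → ℝ} (hf : LocLipOn univ f) : Continuous f := by
  rw [continuous_iff_continuousAt]
  intro x
  obtain ⟨K, t, ht, hL⟩ := hf x (mem_univ x)
  rw [nhdsWithin_univ] at ht
  exact hL.continuousOn.continuousAt ht

theorem Doubling.measure_ball_two_pow_mul_le
    {X : Type*} [MetricSpace X] [MeasurableSpace X]
    {μ : Measure X} {CD : ℝ≥0} (h : Doubling μ CD)
    (n : ℕ) (x : X) {r : ℝ} (hr : 0 < r) :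
    μ (ball x (2 ^ n * r)) ≤ (CD : ℝ≥0∞) ^ n * μ (ball x r) := by
  induction n with
  | zero => simp
  | succ n ih =>
    calc μ (ball x (2 ^ (n + 1) * r)) = μ (ball x (2 * (2 ^ n * r))) := by ring_nf
      _ ≤ CD * μ (ball x (2 ^ n * r)) := h.2 x _ (by positivity)
      _ ≤ CD * ((CD : ℝ≥0∞) ^ n * μ (ball x r)) := by gcongr
      _ = (CD : ℝ≥0∞) ^ (n + 1) * μ (ball x r) := by ring

theorem Doubling.measure_ball_ne_top
    {X : Type*} [MetricSpace X] [MeasurableSpace X]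
    {μ : Measure X} [IsLocallyFiniteMeasure μ] {CD : ℝ≥0}
    (h : Doubling μ CD) (x : X) (r : ℝ) : μ (ball x r) ≠ ∞ := by
  obtain ⟨s, hs, hfin⟩ := μ.finiteAt_nhds x
  obtain ⟨ε, hε, hεs⟩ := Metric.mem_nhds_iff.1 hs
  obtain ⟨n, hn⟩ := pow_unbounded_of_one_lt (r / ε) one_lt_two
  refine ne_top_of_le_ne_top (ENNReal.mul_ne_top (ENNReal.pow_ne_top ENNReal.coe_ne_top)
    ((measure_mono hεs).trans_lt hfin).ne)
    ((measure_mono (ball_subset_ball ?_)).trans (h.measure_ball_two_pow_mul_le n x hε))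
  exact ((div_lt_iff₀ hε).1 hn).le

theorem Doubling.isUnifLocDoublingMeasure
    {X : Type*} [MetricSpace X] [MeasurableSpace X]
    {μ : Measure X} {CD : ℝ≥0} (h : Doubling μ CD) :
    IsUnifLocDoublingMeasure μ := by
  refine ⟨CD ^ 2, ?_⟩
  filter_upwards [self_mem_nhdsWithin] with ε (hε : 0 < ε) x
  calc μ (closedBall x (2 * ε)) ≤ μ (ball x (2 ^ 2 * ε)) :=
        measure_mono (closedBall_subset_ball (by linarith))
    _ ≤ (CD : ℝ≥0∞) ^ 2 * μ (ball x ε) := h.measure_ball_two_pow_mul_le 2 x hε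
    _ ≤ ((CD ^ 2 : ℝ≥0) : ℝ≥0∞) * μ (closedBall x ε) := by
        push_cast
        gcongr
        exact ball_subset_closedBall

/-- Constants are no closer in `L¹(K)` to the indicator of `E` than `0` or `1`. -/
theorem min_measure_le_lintegral_indicator_sub_const
    {X : Type*} [MeasurableSpace X]
    (μ : Measure X) {E K : Set X}
    (hE : MeasurableSet E) (c : ℝ) :
    min (μ (K ∩ E)) (μ (K ∩ Eᶜ)) ≤
      ∫⁻ y in K, ENNReal.ofReal |E.indicator (fun _ => (1 : ℝ)) y - c| ∂μ := by
  have h1 : ∫⁻ y in K, ENNReal.ofReal |E.indicator (fun _ => (1 : ℝ)) y - c| ∂μ =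
      ENNReal.ofReal |1 - c| * μ (K ∩ E) + ENNReal.ofReal |c| * μ (K ∩ Eᶜ) := by
    rw [← lintegral_add_compl _ hE]
    congr 1
    · rw [setLIntegral_congr_fun (g := fun _ => ENNReal.ofReal |1 - c|) hE
        (fun y hy => by simp [hy])]
      rw [setLIntegral_const, Measure.restrict_apply hE, inter_comm]
    · rw [setLIntegral_congr_fun (g := fun _ => ENNReal.ofReal |c|) hE.compl
        (fun y hy => by simp [indicator_of_notMem hy])]
      rw [setLIntegral_const, Measure.restrict_apply hE.compl, inter_comm]
  rw [h1]
  calc min (μ (K ∩ E)) (μ (K ∩ Eᶜ))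
      ≤ (ENNReal.ofReal |1 - c| + ENNReal.ofReal |c|) * min (μ (K ∩ E)) (μ (K ∩ Eᶜ)) := by
        refine le_mul_of_one_le_left (zero_le) ?_
        rw [← ENNReal.ofReal_add (abs_nonneg _) (abs_nonneg _), ENNReal.one_le_ofReal]
        calc (1 : ℝ) = |(1 - c) + c| := by simp
          _ ≤ |1 - c| + |c| := abs_add_le _ _
    _ ≤ _ := by
        rw [add_mul]
        gcongr
        · exact min_le_left _ _
        · exact min_le_right _ _

/-- The limiting energy of a sequence of functions on a set. -/
noncomputable def energy (μ : Measure X) (fn : ℕ → X → ℝ) (U : Set X) : ℝ≥0∞ :=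
  liminf (fun n => ∫⁻ x in U, lipConst (fn n) x ∂μ) atTop

theorem tsum_energy_le
    {X : Type*} [MetricSpace X] [MeasurableSpace X]
    (μ : Measure X) (fn : ℕ → X → ℝ) {ι : Type*} [Countable ι]
    (U : ι → Set X) (hU : ∀ i, MeasurableSet (U i)) (hd : Pairwise (Function.onFun Disjoint U)) :
    ∑' i, energy μ fn (U i) ≤ energy μ fn univ := by
  let _ : MeasurableSpace ι := ⊤
  calc ∑' i, energy μ fn (U i)
      = ∫⁻ i, energy μ fn (U i) ∂Measure.count := (lintegral_count _).symm
    _ ≤ liminf (fun n => ∫⁻ i, ∫⁻ x in U i, lipConst (fn n) x ∂μ ∂Measure.count) atTop :=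
        lintegral_liminf_le fun n => measurable_from_top
    _ ≤ energy μ fn univ := by
        refine liminf_le_liminf (Eventually.of_forall fun n => ?_)
        rw [lintegral_count, ← lintegral_iUnion hU hd]
        exact lintegral_mono_set (subset_univ _)

/-- Relative isoperimetric inequality on balls, for the energy of an approximating sequence. -/
theorem WeakPoincare.min_measure_ball_le {μ : Measure X} [IsLocallyFiniteMeasure μ] {CP lam : ℝ}
    (hP : WeakPoincare μ CP lam) (hCP : 0 < CP) {E : Set X} (hE : MeasurableSet E)
    {fn : ℕ → X → ℝ} (hfn : ∀ n, LocLipOn univ (fn n))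
    (hlim : TendstoL1loc μ univ fn (E.indicator fun _ => (1 : ℝ))) (x : X) {r : ℝ} (hr : 0 < r) :
    min (μ (ball x r ∩ E)) (μ (ball x r ∩ Eᶜ)) ≤
      ENNReal.ofReal (CP * r) * energy μ fn (ball x (lam * r)) := by
  have := UniformSpace.secondCountable_of_separable X
  set A := ENNReal.ofReal (CP * r) with hA
  have hA0 : A ≠ 0 := (ENNReal.ofReal_pos.2 (mul_pos hCP hr)).ne'
  have hAt : A ≠ ∞ := ENNReal.ofReal_ne_top
  have compact_case : ∀ K : Set X, IsCompact K → K ⊆ ball x r →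
      min (μ (K ∩ E)) (μ (K ∩ Eᶜ)) ≤ A * energy μ fn (ball x (lam * r)) := by
    intro K hK hKB
    set δ : ℕ → ℝ≥0∞ := fun n =>
      ∫⁻ y in K, ENNReal.ofReal |fn n y - E.indicator (fun _ => (1 : ℝ)) y| ∂μ
    have hδ : Tendsto δ atTop (𝓝 0) := hlim K hK (subset_univ _)
    set M := min (μ (K ∩ E)) (μ (K ∩ Eᶜ))
    have hM : M ≠ ∞ :=
      ne_top_of_le_ne_top hK.measure_lt_top.ne
        ((min_le_left _ _).trans (measure_mono inter_subset_left))
    have bound : ∀ n, M ≤ δ n + A * ∫⁻ y in ball x (lam * r), lipConst (fn n) y ∂μ := by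
      intro n
      set c := ballAvg μ (fn n) x r
      calc M ≤ ∫⁻ y in K, ENNReal.ofReal |E.indicator (fun _ => (1 : ℝ)) y - c| ∂μ :=
            min_measure_le_lintegral_indicator_sub_const μ hE c
        _ ≤ ∫⁻ y in K, (ENNReal.ofReal |fn n y - E.indicator (fun _ => (1 : ℝ)) y| +
              ENNReal.ofReal |fn n y - c|) ∂μ := by
            refine lintegral_mono fun y => ?_
            rw [← ENNReal.ofReal_add (abs_nonneg _) (abs_nonneg _)]
            refine ENNReal.ofReal_le_ofReal ?_
            rw [abs_sub_comm (fn n y)]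
            exact abs_sub_le _ _ _
        _ = δ n + ∫⁻ y in K, ENNReal.ofReal |fn n y - c| ∂μ := by
            have := (hfn n).continuous
            exact lintegral_add_right _ (by fun_prop)
        _ ≤ δ n + ∫⁻ y in ball x r, ENNReal.ofReal |fn n y - c| ∂μ := by
            gcongr
        _ ≤ _ := by
            gcongr
            exact hP _ (hfn n) x r hr
    have htends : Tendsto (fun n => (M - δ n) / A) atTop (𝓝 (M / A)) := by
      simpa using ENNReal.Tendsto.div_const
        (ENNReal.Tendsto.sub tendsto_const_nhds hδ (Or.inl hM)) (Or.inr hA0)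
    have hdiv : M / A ≤ energy μ fn (ball x (lam * r)) := by
      rw [← htends.liminf_eq]
      refine liminf_le_liminf (Eventually.of_forall fun n => ?_)
      refine ENNReal.div_le_of_le_mul' ?_
      exact tsub_le_iff_left.2 (bound n)
    rw [mul_comm]
    exact (ENNReal.div_le_iff hA0 hAt).1 hdiv
  refine le_of_forall_lt fun t ht => ?_
  obtain ⟨K₁, hK₁, hc₁, ht₁⟩ :=
    (measurableSet_ball.inter hE).exists_lt_isCompact (ht.trans_le (min_le_left _ _))
  obtain ⟨K₂, hK₂, hc₂, ht₂⟩ :=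
    (measurableSet_ball.inter hE.compl).exists_lt_isCompact (ht.trans_le (min_le_right _ _))
  refine lt_of_lt_of_le (lt_min ?_ ?_) (compact_case (K₁ ∪ K₂) (hc₁.union hc₂)
    (union_subset (hK₁.trans inter_subset_left) (hK₂.trans inter_subset_left)))
  · exact ht₁.trans_le (measure_mono (subset_inter subset_union_left (hK₁.trans inter_subset_right)))
  · exact ht₂.trans_le
      (measure_mono (subset_inter subset_union_right (hK₂.trans inter_subset_right)))

/-- Around almost every point of `E`, at some dyadic scale below a given one, `Eᶜ` occupies at most
a prescribed fraction of the ball. -/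
theorem Doubling.ae_exists_measure_ball_inter_compl_le
    {X : Type*} [MetricSpace X] [TopologicalSpace.SeparableSpace X] [MeasurableSpace X] [BorelSpace X]
    {μ : Measure X} [IsLocallyFiniteMeasure μ]
    {CD : ℝ≥0} (h : Doubling μ CD) {E : Set X} (hE : MeasurableSet E) {ρ : ℝ} (hρ : 0 < ρ)
    {M : ℝ≥0} (hM : M ≠ 0) :
    ∀ᵐ x ∂μ, x ∈ E → ∃ j : ℕ, M * μ (ball x (ρ / 2 ^ j) ∩ Eᶜ) ≤ μ (ball x (ρ / 2 ^ j)) := by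
  have := UniformSpace.secondCountable_of_separable X
  have := h.isUnifLocDoublingMeasure
  have hC : CD ≠ 0 := (zero_lt_one.trans_le h.1).ne'
  filter_upwards [(IsUnifLocDoublingMeasure.vitaliFamily μ
    1).ae_tendsto_measure_inter_div_of_measurableSet hE.compl] with x hx hxE
  have hpos : ∀ j : ℕ, 0 < ρ / 2 ^ j := fun j => by positivity
  have hδ : Tendsto (fun j : ℕ => ρ / 2 ^ j) atTop (𝓝[>] 0) := by
    refine tendsto_nhdsWithin_iff.2 ⟨?_, Eventually.of_forall hpos⟩
    have := (tendsto_pow_atTop_nhds_zero_of_lt_one (r := (1 / 2 : ℝ)) (by norm_num)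
      (by norm_num)).const_mul ρ
    simpa [div_eq_mul_inv] using this
  have hlim := hx.comp (IsUnifLocDoublingMeasure.tendsto_closedBall_filterAt (μ := μ) (K := 1)
    (x := x) (fun _ => x) _ hδ
    (Eventually.of_forall fun j => mem_closedBall_self (by linarith [hpos j])))
  rw [indicator_of_notMem (by simpa using hxE)] at hlim
  have hε : (0 : ℝ≥0∞) < ((M * CD)⁻¹ : ℝ≥0) := by
    exact_mod_cast pos_iff_ne_zero.2 (inv_ne_zero (mul_ne_zero hM hC))
  obtain ⟨j, hj⟩ := (hlim.eventually_lt_const hε).exists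
  refine ⟨j, ?_⟩
  set r := ρ / 2 ^ j
  have hr : 0 < r := hpos j
  have hcb : μ (closedBall x r) ≤ CD * μ (ball x r) :=
    (measure_mono (closedBall_subset_ball (by linarith))).trans (h.2 x r hr)
  have hle : μ (Eᶜ ∩ closedBall x r) ≤ ((M * CD)⁻¹ : ℝ≥0) * μ (closedBall x r) := by
    by_cases h0 : μ (closedBall x r) = 0
    · rw [measure_mono_null inter_subset_right h0]
      exact zero_le
    · refine (ENNReal.div_le_iff h0 ?_).1 hj.le
      exact ne_top_of_le_ne_top
        (ENNReal.mul_ne_top ENNReal.coe_ne_top (h.measure_ball_ne_top x r)) hcb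
  calc M * μ (ball x r ∩ Eᶜ) ≤ M * (((M * CD)⁻¹ : ℝ≥0) * (CD * μ (ball x r))) := by
        gcongr
        refine le_trans ?_ (hle.trans ?_)
        · rw [inter_comm]
          gcongr
          exact ball_subset_closedBall
        · gcongr
    _ = ((M * (M * CD)⁻¹ * CD : ℝ≥0) : ℝ≥0∞) * μ (ball x r) := by
        push_cast
        ring
    _ = μ (ball x r) := by
        rw [show M * (M * CD)⁻¹ * CD = 1 by field_simp]
        simp

/-- If `E` fills at most half of a ball, then almost every point of `E` in this ball is the center
of a ball in which both `E` and `Eᶜ` occupy a definite fraction. -/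
theorem Doubling.ae_exists_balanced_ball
    {X : Type*} [MetricSpace X] [TopologicalSpace.SeparableSpace X] [MeasurableSpace X] [BorelSpace X]
    {μ : Measure X} [IsLocallyFiniteMeasure μ]
    {CD : ℝ≥0} (h : Doubling μ CD) {E : Set X} (hE : MeasurableSet E) {x₀ : X} {R : ℝ} (hR : 0 < R)
    (hhalf : μ (ball x₀ R ∩ E) ≤ μ (ball x₀ R ∩ Eᶜ)) :
    ∀ᵐ x ∂μ, x ∈ ball x₀ R ∩ E → ∃ r : ℝ, 0 < r ∧ r ≤ 2 * R ∧
      μ (ball x r) ≤ 2 * CD ^ 2 * min (μ (ball x r ∩ E)) (μ (ball x r ∩ Eᶜ)) := by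
  have hC : (1 : ℝ≥0∞) ≤ CD := by exact_mod_cast h.1
  have hM : 2 * CD ^ 2 ≠ 0 := (mul_pos two_pos (pow_pos (zero_lt_one.trans_le h.1) 2)).ne'
  have hsplit : ∀ x r, μ (ball x r ∩ E) + μ (ball x r ∩ Eᶜ) = μ (ball x r) := fun x r => by
    rw [← sdiff_eq]
    exact measure_inter_add_sdiff _ hE
  filter_upwards [h.ae_exists_measure_ball_inter_compl_le hE (mul_pos two_pos hR) hM] with x hx hxE
  classical
  have hex := hx hxE.2
  have hj := Nat.find_spec hex
  have hmin := fun i => Nat.find_min (m := i) hex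
  set j := Nat.find hex
  set ρ : ℕ → ℝ := fun i => 2 * R / 2 ^ i with hρ
  have hpos : ∀ i, 0 < ρ i := fun i => by positivity
  push_cast at hj hmin
  change 2 * (CD : ℝ≥0∞) ^ 2 * μ (ball x (ρ j) ∩ Eᶜ) ≤ μ (ball x (ρ j)) at hj
  have hinner : μ (ball x (ρ j)) ≤ 2 * μ (ball x (ρ j) ∩ E) := by
    have hle : μ (ball x (ρ j) ∩ Eᶜ) + μ (ball x (ρ j) ∩ Eᶜ) ≤
        μ (ball x (ρ j) ∩ E) + μ (ball x (ρ j) ∩ Eᶜ) := by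
      rw [hsplit, ← two_mul]
      refine le_trans ?_ hj
      gcongr
      exact le_mul_of_one_le_right (zero_le) (one_le_pow₀ hC)
    have hfin : μ (ball x (ρ j) ∩ Eᶜ) ≠ ∞ :=
      ne_top_of_le_ne_top (h.measure_ball_ne_top x (ρ j)) (measure_mono inter_subset_left)
    have := (ENNReal.add_le_add_iff_right hfin).1 hle
    rw [← hsplit, two_mul]
    gcongr
  rcases Nat.eq_zero_or_pos j with h0 | hjpos
  · have hρ0 : ρ j = 2 * R := by simp [hρ, h0]
    rw [hρ0] at hinner
    refine ⟨2 * R, by linarith, le_rfl, ?_⟩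
    rw [mul_min]
    refine le_min (hinner.trans ?_) ?_
    · gcongr
      exact le_mul_of_one_le_right (zero_le) (one_le_pow₀ hC)
    · have hdist : dist x x₀ < R := hxE.1
      calc μ (ball x (2 * R)) ≤ μ (ball x₀ (2 ^ 2 * R)) :=
            measure_mono (ball_subset_ball' (by linarith))
        _ ≤ CD ^ 2 * μ (ball x₀ R) := h.measure_ball_two_pow_mul_le 2 x₀ hR
        _ ≤ CD ^ 2 * (2 * μ (ball x₀ R ∩ Eᶜ)) := by
            rw [← hsplit, two_mul]
            gcongr
        _ = 2 * CD ^ 2 * μ (ball x₀ R ∩ Eᶜ) := by ring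
        _ ≤ 2 * CD ^ 2 * μ (ball x (2 * R) ∩ Eᶜ) := by
            gcongr
            exact ball_subset_ball' (by rw [dist_comm]; linarith)
  · obtain ⟨i, hi⟩ := Nat.exists_eq_add_of_le' hjpos
    have hρi : ρ i = 2 * ρ j := by
      simp only [hρ, hi, pow_succ]
      field_simp
    refine ⟨ρ i, hpos i, ?_, ?_⟩
    · exact div_le_self (by linarith) (one_le_pow₀ one_le_two)
    rw [mul_min]
    refine le_min ?_ (not_le.1 (hmin i (by omega))).le
    calc μ (ball x (ρ i)) ≤ CD * μ (ball x (ρ j)) := by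
          rw [hρi]
          exact h.2 x _ (hpos j)
      _ ≤ CD ^ 2 * (2 * μ (ball x (ρ j) ∩ E)) := by
          gcongr
          exact le_self_pow₀ hC two_ne_zero
      _ ≤ CD ^ 2 * (2 * μ (ball x (ρ i) ∩ E)) := by
          gcongr
          linarith [hpos j]
      _ = 2 * CD ^ 2 * μ (ball x (ρ i) ∩ E) := by ring

theorem energy_mono
    {X : Type*} [MetricSpace X] [MeasurableSpace X]
    (μ : Measure X) (fn : ℕ → X → ℝ) {U V : Set X} (h : U ⊆ V) :
    energy μ fn U ≤ energy μ fn V :=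
  liminf_le_liminf (Eventually.of_forall fun _ => lintegral_mono_set h)

/-- In a ball half-filled by `E` at most, the measure of `E` is controlled by a power of the energy
of an approximating sequence. -/
theorem Doubling.measure_ball_inter_le
    {X : Type*} [MetricSpace X] [TopologicalSpace.SeparableSpace X] [MeasurableSpace X] [BorelSpace X]
    {μ : Measure X} [IsLocallyFiniteMeasure μ] {CD : ℝ≥0}
    (h : Doubling μ CD) {E : Set X} (hE : MeasurableSet E) {fn : ℕ → X → ℝ} {CP lam a k R : ℝ}
    {N : ℕ} (hCP : 0 < CP) (hlam : 1 ≤ lam) (ha : 0 < a) (hk : 1 < k) (hR : 0 < R)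
    (hN : 5 * lam < 2 ^ N)
    (hiso : ∀ x r, 0 < r → min (μ (ball x r ∩ E)) (μ (ball x r ∩ Eᶜ)) ≤
      ENNReal.ofReal (CP * r) * energy μ fn (ball x (lam * r)))
    (hlow : ∀ x r, 0 < r → r ≤ 2 * R → ENNReal.ofReal (a * r ^ k) ≤ μ (ball x r))
    {x₀ : X} (hhalf : μ (ball x₀ R ∩ E) ≤ μ (ball x₀ R ∩ Eᶜ)) (hfin : energy μ fn univ ≠ ∞) :
    μ (ball x₀ R ∩ E) ≤
      ENNReal.ofReal (CD ^ N * (2 * CD ^ 2 * CP) * (2 * CD ^ 2 * CP / a) ^ (1 / (k - 1))) *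
        energy μ fn univ ^ (k / (k - 1)) := by
  have hC : (0 : ℝ) < CD := by exact_mod_cast zero_lt_one.trans_le h.1
  set K : ℝ := 2 * CD ^ 2 * CP with hK
  have hKpos : 0 < K := by positivity
  obtain ⟨A, hA⟩ : ∃ A : ℝ≥0, energy μ fn univ = A := ⟨_, (ENNReal.coe_toNNReal hfin).symm⟩
  set ρ : ℝ := (K / a * A) ^ (1 / (k - 1)) with hρ
  have hρ0 : 0 ≤ ρ := by positivity
  set G : Set X := {x ∈ ball x₀ R ∩ E | ∃ r : ℝ, 0 < r ∧ r ≤ 2 * R ∧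
    μ (ball x r) ≤ 2 * CD ^ 2 * min (μ (ball x r ∩ E)) (μ (ball x r ∩ Eᶜ))} with hG
  have hEG : μ (ball x₀ R ∩ E) ≤ μ G := by
    refine measure_mono_ae ?_
    filter_upwards [h.ae_exists_balanced_ball hE hR hhalf] with x hx hxE
    exact ⟨hxE, hx hxE⟩
  choose! r hr0 hrR hrμ using fun x (hx : x ∈ G) => hx.2
  have hball : ∀ x ∈ G, μ (ball x (r x)) ≤ ENNReal.ofReal (K * r x) *
      energy μ fn (ball x (lam * r x)) := by
    intro x hx
    calc μ (ball x (r x)) ≤ 2 * CD ^ 2 *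
          (ENNReal.ofReal (CP * r x) * energy μ fn (ball x (lam * r x))) := by
          refine (hrμ x hx).trans ?_
          gcongr
          exact hiso x _ (hr0 x hx)
      _ = ENNReal.ofReal (K * r x) * energy μ fn (ball x (lam * r x)) := by
          have hcast : ENNReal.ofReal (2 * (CD : ℝ) ^ 2) = 2 * (CD : ℝ≥0∞) ^ 2 := by
            rw [ENNReal.ofReal_mul zero_le_two, ENNReal.ofReal_pow hC.le]
            simp
          rw [hK, mul_assoc (2 * (CD : ℝ) ^ 2),
            ENNReal.ofReal_mul (p := 2 * (CD : ℝ) ^ 2) (by positivity), hcast]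
          ring
  have hrρ : ∀ x ∈ G, r x ≤ ρ := by
    intro x hx
    have hrx := hr0 x hx
    have hle : a * r x ^ k ≤ K * r x * A := by
      have := calc ENNReal.ofReal (a * r x ^ k) ≤ μ (ball x (r x)) := hlow x _ hrx (hrR x hx)
        _ ≤ ENNReal.ofReal (K * r x) * energy μ fn univ := by
            refine (hball x hx).trans ?_
            gcongr
            exact energy_mono μ fn (subset_univ _)
        _ = ENNReal.ofReal (K * r x * A) := by
            rw [hA, ENNReal.ofReal_mul (p := K * r x) (by positivity), ENNReal.ofReal_coe_nnreal]
      exact (ENNReal.ofReal_le_ofReal_iff (by positivity)).1 this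
    have hpow : r x ^ (k - 1) ≤ K / a * A := by
      rw [Real.rpow_sub_one hrx.ne', div_mul_eq_mul_div, div_le_div_iff₀ hrx ha]
      linarith
    calc r x = (r x ^ (k - 1)) ^ (1 / (k - 1)) := by
          rw [← Real.rpow_mul hrx.le, mul_one_div_cancel (by linarith), Real.rpow_one]
      _ ≤ ρ := Real.rpow_le_rpow (by positivity) hpow (one_div_nonneg.2 (by linarith))
  obtain ⟨u, huG, hdisj, hcov⟩ := Vitali.exists_disjoint_subfamily_covering_enlargement_closedBall
    G id (fun x => lam * r x) (lam * (2 * R))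
    (fun x hx => mul_le_mul_of_nonneg_left (hrR x hx) (by linarith)) 5 (by norm_num)
  have hdisj' : u.PairwiseDisjoint fun x => ball x (lam * r x) :=
    hdisj.mono fun x => ball_subset_closedBall
  have hucount : u.Countable := hdisj'.countable_of_isOpen (fun x _ => isOpen_ball)
    fun x hx => nonempty_ball.2 (mul_pos (by linarith) (hr0 x (huG hx)))
  have := hucount.to_subtype
  have hGu : G ⊆ ⋃ b : u, ball (b : X) (2 ^ N * r b) := by
    intro x hx
    obtain ⟨b, hb, hsub⟩ := hcov x hx
    have hrb := hr0 b (huG hb)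
    refine mem_iUnion.2 ⟨⟨b, hb⟩, ?_⟩
    refine closedBall_subset_ball ?_ (hsub (mem_closedBall_self
      (mul_nonneg (by linarith) (hr0 x hx).le)))
    nlinarith
  calc μ (ball x₀ R ∩ E) ≤ ∑' b : u, μ (ball (b : X) (2 ^ N * r b)) :=
        hEG.trans ((measure_mono hGu).trans (measure_iUnion_le _))
    _ ≤ ∑' b : u, (CD : ℝ≥0∞) ^ N * ENNReal.ofReal (K * ρ) *
          energy μ fn (ball (b : X) (lam * r b)) := by
        refine ENNReal.tsum_le_tsum fun b => ?_
        refine (h.measure_ball_two_pow_mul_le N _ (hr0 b (huG b.2))).trans ?_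
        rw [mul_assoc]
        gcongr
        refine (hball b (huG b.2)).trans ?_
        gcongr
        exact hrρ b (huG b.2)
    _ ≤ (CD : ℝ≥0∞) ^ N * ENNReal.ofReal (K * ρ) * energy μ fn univ := by
        rw [ENNReal.tsum_mul_left]
        gcongr
        exact tsum_energy_le μ fn _ (fun b => measurableSet_ball) (hdisj'.subtype _ _)
    _ = ENNReal.ofReal (CD ^ N * (K * ρ) * A) := by
        rw [hA, ENNReal.ofReal_mul (p := CD ^ N * (K * ρ)) (by positivity),
          ENNReal.ofReal_mul (p := (CD : ℝ) ^ N) (by positivity), ENNReal.ofReal_pow hC.le]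
        simp only [ENNReal.ofReal_coe_nnreal]
    _ = ENNReal.ofReal (CD ^ N * K * (K / a) ^ (1 / (k - 1)) * (A : ℝ) ^ (k / (k - 1))) := by
        have hk1 : k - 1 ≠ 0 := by linarith
        have hexp : k / (k - 1) = 1 / (k - 1) + 1 := by field_simp; ring
        have hs : 0 < 1 / (k - 1) := one_div_pos.2 (by linarith)
        rw [hρ, Real.mul_rpow (by positivity) (by positivity), hexp,
          Real.rpow_add_of_nonneg (by positivity) hs.le zero_le_one, Real.rpow_one]
        ring_nf
    _ = _ := by
        rw [hA, ENNReal.ofReal_mul (by positivity),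
          ← ENNReal.ofReal_rpow_of_nonneg (by positivity)
            (div_nonneg (by linarith) (by linarith)), ENNReal.ofReal_coe_nnreal]

/-- The lower Ahlfors bound persists, with a worse constant, slightly beyond the diameter. -/
theorem AhlforsRegular.exists_lower_bound
    {X : Type*} [MetricSpace X] [MeasurableSpace X]
    {μ : Measure X} {k : ℝ} (h : AhlforsRegular μ k) :
    ∃ a : ℝ, 0 < a ∧ ∀ (x : X) (r : ℝ), 0 < r →
      ENNReal.ofReal (r / 8) < ediam (univ : Set X) →
        ENNReal.ofReal (a * r ^ k) ≤ μ (ball x r) := by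
  obtain ⟨a, _, ha, _, hb⟩ := h
  refine ⟨a / 8 ^ k, by positivity, fun x r hr hdiam => ?_⟩
  calc ENNReal.ofReal (a / 8 ^ k * r ^ k) = ENNReal.ofReal (a * (r / 8) ^ k) := by
        rw [Real.div_rpow hr.le (by norm_num)]
        ring_nf
    _ ≤ μ (ball x (r / 8)) := (hb x _ (by positivity) hdiam).1
    _ ≤ μ (ball x r) := measure_mono (ball_subset_ball (by linarith))

theorem perim_univ_eq
    {X : Type*} [MetricSpace X] [MeasurableSpace X]
    (μ : Measure X) (E : Set X) :
    perim μ E univ = tvOpen μ (E.indicator fun _ => (1 : ℝ)) univ := by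
  refine le_antisymm (iInf₂_le_of_le univ isOpen_univ (iInf_le _ Subset.rfl)) ?_
  refine le_iInf₂ fun Ω _ => le_iInf fun h => ?_
  rw [univ_subset_iff.1 h]

/-- A bound on the minimum over arbitrarily large balls is a global bound. -/
theorem min_measure_le_of_forall_ball
    {X : Type*} [MetricSpace X] [MeasurableSpace X]
    {μ : Measure X} {E : Set X} {B : ℝ≥0∞} (x₀ : X)
    (h : ∀ R : ℝ, 0 < R → min (μ (ball x₀ R ∩ E)) (μ (ball x₀ R ∩ Eᶜ)) ≤ B) :
    min (μ E) (μ Eᶜ) ≤ B := by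
  have hmono : ∀ S : Set X, Monotone fun n : ℕ => ball x₀ ((n : ℝ) + 1) ∩ S := fun S m n hmn =>
    inter_subset_inter_left _ (ball_subset_ball (by gcongr))
  have hunion : ∀ S : Set X, ⋃ n : ℕ, ball x₀ ((n : ℝ) + 1) ∩ S = S := fun S => by
    rw [← iUnion_inter, inter_eq_right]
    intro y _
    obtain ⟨n, hn⟩ := exists_nat_gt (dist y x₀)
    exact mem_iUnion.2 ⟨n, mem_ball.2 (by linarith)⟩
  have hlim : ∀ S : Set X, Tendsto (fun n : ℕ => μ (ball x₀ ((n : ℝ) + 1) ∩ S)) atTop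
      (𝓝 (μ S)) := fun S => by
    have := tendsto_measure_iUnion_atTop (μ := μ) (hmono S)
    rwa [hunion] at this
  exact le_of_tendsto ((hlim E).min (hlim Eᶜ)) (Eventually.of_forall fun n => h _ (by positivity))

/-- Global isoperimetric inequality on Ahlfors-regular PI spaces. -/
theorem global_isoperimetric_inequality
    (μ : Measure X) [IsLocallyFiniteMeasure μ] (hμ : μ ≠ 0)
    (k : ℝ) (hk : 1 < k) (hAhl : AhlforsRegular μ k) (hPI : IsPI μ) :
    ∃ C : ℝ, 0 < C ∧ ∀ E : Set X, FinPerim μ E →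
      min (μ E) (μ Eᶜ) ≤ ENNReal.ofReal C * perim μ E Set.univ ^ (k / (k - 1)) := by
  obtain ⟨CD, CP, lam, hD, hCP, hlam, hP⟩ := hPI
  obtain ⟨a, ha, hlow⟩ := hAhl.exists_lower_bound
  obtain ⟨N, hN⟩ := pow_unbounded_of_one_lt (5 * lam) one_lt_two
  have hC : (0 : ℝ) < CD := by exact_mod_cast zero_lt_one.trans_le hD.1
  set C : ℝ := CD ^ N * (2 * CD ^ 2 * CP) * (2 * CD ^ 2 * CP / a) ^ (1 / (k - 1))
  have hCpos : 0 < C := by positivity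
  have hq : 0 < k / (k - 1) := div_pos (by linarith) (by linarith)
  refine ⟨C, hCpos, fun E hE => ?_⟩
  rcases subsingleton_or_nontrivial X with hX | hX
  · rcases E.eq_empty_or_nonempty with h | h
    · simp [h]
    · simp [Subsingleton.eq_univ_of_nonempty h]
  have x₀ : X := Classical.arbitrary X
  suffices henergy : ∀ fn : ℕ → X → ℝ, (∀ n, LocLipOn univ (fn n)) →
      TendstoL1loc μ univ fn (E.indicator fun _ => (1 : ℝ)) →
      min (μ E) (μ Eᶜ) ≤ ENNReal.ofReal C * energy μ fn univ ^ (k / (k - 1)) by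
    have hC0 : ENNReal.ofReal C ≠ 0 := (ENNReal.ofReal_pos.2 hCpos).ne'
    rw [← ENNReal.div_le_iff' hC0 ENNReal.ofReal_ne_top, ← ENNReal.rpow_inv_le_iff hq, perim_univ_eq]
    refine le_sInf ?_
    rintro _ ⟨fn, hfn, hlim, rfl⟩
    rw [ENNReal.rpow_inv_le_iff hq, ENNReal.div_le_iff' hC0 ENNReal.ofReal_ne_top]
    exact henergy fn hfn hlim
  intro fn hfn hlim
  by_cases hfin : energy μ fn univ = ∞
  · simp [hfin, ENNReal.top_rpow_of_pos hq, ENNReal.mul_top, hCpos]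
  have hiso := fun x r => hP.min_measure_ball_le hCP hE.1 hfn hlim x (r := r)
  have hball : ∀ R : ℝ, 0 < R → ENNReal.ofReal (R / 4) < ediam (univ : Set X) →
      min (μ (ball x₀ R ∩ E)) (μ (ball x₀ R ∩ Eᶜ)) ≤
        ENNReal.ofReal C * energy μ fn univ ^ (k / (k - 1)) := by
    intro R hR hdiam
    have hlowR : ∀ x r, 0 < r → r ≤ 2 * R → ENNReal.ofReal (a * r ^ k) ≤ μ (ball x r) :=
      fun x r hr hrR => hlow x r hr
        ((ENNReal.ofReal_le_ofReal (by linarith)).trans_lt hdiam)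
    rcases le_total (μ (ball x₀ R ∩ E)) (μ (ball x₀ R ∩ Eᶜ)) with hle | hle
    · exact (min_le_left _ _).trans
        (hD.measure_ball_inter_le hE.1 hCP hlam ha hk hR hN hiso hlowR hle hfin)
    · refine (min_le_right _ _).trans
        (hD.measure_ball_inter_le hE.1.compl hCP hlam ha hk hR hN ?_ hlowR ?_ hfin)
      · intro x r hr
        rw [compl_compl, min_comm]
        exact hiso x r hr
      · rwa [compl_compl]
  by_cases hdiam : ediam (univ : Set X) = ∞
  · exact min_measure_le_of_forall_ball x₀ fun R hR =>
      hball R hR (hdiam ▸ ENNReal.ofReal_lt_top)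
  · have hbdd : Bornology.IsBounded (univ : Set X) :=
      Metric.isBounded_iff_ediam_ne_top.2 hdiam
    have hpos : 0 < diam (univ : Set X) := Metric.diam_pos nontrivial_univ hbdd
    have huniv : ball x₀ (2 * diam (univ : Set X)) = univ := by
      refine eq_univ_of_forall fun y => mem_ball.2 ?_
      linarith [dist_le_diam_of_mem hbdd (mem_univ y) (mem_univ x₀)]
    have := hball (2 * diam (univ : Set X)) (by linarith)
      ((ENNReal.ofReal_lt_iff_lt_toReal (by positivity) hdiam).2 (by
        change _ < diam (univ : Set X)
        linarith))
    simpa [huniv] using this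

end PaperBV
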